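/- arXiv:1112.1335 — 2 statements merged into one kernel-verified Lean document; each statement's English description precedes it below -/
import Mathlib

section
/- If there is an arc (j, i) from a leader j ∈ 𝒱_L into a follower i ∈ 𝒱_F present in G_{σ(t)} for all t ∈ [t₀, t₀ + τ_D), then, with λ = b_* + (n−1)a^* and the strictly decreasing function δ(s) = (b_* e^{−λs} + (n−1)a^*)/λ mapping [0, τ_D] into (0, 1] with δ(0) = 1, one has dist(x_i(t), ℒ(y(t))) ≤ δ(t − t₀) · |x(t₀)|_{ℒ(y(t₀))} + 2√2 ∫_{t₀}^{t₀+τ_D} |z(s)| ds for all t ∈ [t₀, t₀ + τ_D]. -/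
open Metric Set Filter MeasureTheory

noncomputable section

/-- Data of the multi-agent system (5): the switching communication topology
(neighbor sets `Nb`, leader sets `Ld`), the weight functions `A` (= `a_{ij}`),
`B` (= `b_{ij}`), the dwell time `τD` and the weight bounds `aLo = a_*`,
`aHi = a^*`, `bLo = b_*`, together with Assumptions 1 and 2. -/
structure MASData (d n k : ℕ) where
  hn : 2 ≤ n
  hk : 1 ≤ k
  Nb : ℝ → Fin n → Finset (Fin n)
  Ld : ℝ → Fin n → Finset (Fin k)
  A : Fin n → Fin n → (Fin n → EuclideanSpace ℝ (Fin d)) →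
    (Fin k → EuclideanSpace ℝ (Fin d)) → ℝ → ℝ
  B : Fin n → Fin k → (Fin n → EuclideanSpace ℝ (Fin d)) →
    (Fin k → EuclideanSpace ℝ (Fin d)) → ℝ → ℝ
  τD : ℝ
  aLo : ℝ
  aHi : ℝ
  bLo : ℝ
  τD_pos : 0 < τD
  aLo_pos : 0 < aLo
  bLo_pos : 0 < bLo
  A_bdd : ∀ i j xv yv t, aLo ≤ A i j xv yv t ∧ A i j xv yv t ≤ aHi
  B_bdd : ∀ i j xv yv t, bLo ≤ B i j xv yv t
  A_cont : ∀ i j, Continuous fun p :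
    (Fin n → EuclideanSpace ℝ (Fin d)) × (Fin k → EuclideanSpace ℝ (Fin d)) × ℝ =>
    A i j p.1 p.2.1 p.2.2
  B_cont : ∀ i j, Continuous fun p :
    (Fin n → EuclideanSpace ℝ (Fin d)) × (Fin k → EuclideanSpace ℝ (Fin d)) × ℝ =>
    B i j p.1 p.2.1 p.2.2
  /-- The topology is piecewise constant with consecutive switching instants
  separated by at least the dwell time `τD` (Assumption 1). -/
  dwell : ∃ s : ℕ → ℝ, s 0 = 0 ∧ (∀ m : ℕ, s m + τD ≤ s (m + 1)) ∧
    ∀ m : ℕ, ∀ t₁ ∈ Set.Ico (s m) (s (m + 1)), ∀ t₂ ∈ Set.Ico (s m) (s (m + 1)),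
      Nb t₁ = Nb t₂ ∧ Ld t₁ = Ld t₂

namespace MASData

variable {d n k : ℕ}

/-- The arc relation of the communication graph at time `t`, on the node set
`Fin k ⊕ Fin n` (leaders ⊕ followers).  `arcAt t v v'` means there is an arc
leaving `v` and entering `v'`; there are no arcs from followers into leaders. -/
def arcAt (D : MASData d n k) (t : ℝ) (v v' : Fin k ⊕ Fin n) : Prop :=
  match v, v' with
  | Sum.inl j, Sum.inr i => j ∈ D.Ld t i
  | Sum.inr j, Sum.inr i => j ∈ D.Nb t i
  | _, _ => False

/-- Arc relation of the union graph over the set of times `T`. -/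
def arcOn (D : MASData d n k) (T : Set ℝ) (v v' : Fin k ⊕ Fin n) : Prop :=
  ∃ t ∈ T, D.arcAt t v v'

/-- The union graph over the set of times `T` is L-connected: every follower is
reachable from some leader by a directed path. -/
def LConnectedOn (D : MASData d n k) (T : Set ℝ) : Prop :=
  ∀ i : Fin n, ∃ j : Fin k, Relation.ReflTransGen (D.arcOn T) (Sum.inl j) (Sum.inr i)

/-- Uniformly jointly L-connected. -/
def UJLC (D : MASData d n k) : Prop :=
  ∃ T > (0:ℝ), ∀ t ≥ (0:ℝ), D.LConnectedOn (Set.Ico t (t + T))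

/-- Jointly L-connected. -/
def JLC (D : MASData d n k) : Prop :=
  ∀ t ≥ (0:ℝ), D.LConnectedOn (Set.Ici t)

end MASData

/-- A solution (trajectory) of system (5) together with its inputs: leader
controls `u`, disturbances `w`, follower states `x` and leader states `y`;
the dynamics hold in the sense of right derivatives for `t ≥ 0`, and the
(piecewise continuous) inputs are locally interval integrable along the
solution. -/
structure MASSol {d n k : ℕ} (D : MASData d n k) where
  x : ℝ → Fin n → EuclideanSpace ℝ (Fin d)
  y : ℝ → Fin k → EuclideanSpace ℝ (Fin d)
  u : Fin k → (Fin k → EuclideanSpace ℝ (Fin d)) → ℝ → EuclideanSpace ℝ (Fin d)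
  w : Fin n → ℝ → EuclideanSpace ℝ (Fin d)
  u_cont : ∀ j t, Continuous fun yv => u j yv t
  w_cont : ∀ i, Continuous (w i)
  x_cont : ∀ i, Continuous fun t => x t i
  y_cont : ∀ j, Continuous fun t => y t j
  dyn_y : ∀ (j : Fin k), ∀ t ≥ (0:ℝ),
    HasDerivWithinAt (fun s => y s j) (u j (y t) t) (Set.Ici t) t
  dyn_x : ∀ (i : Fin n), ∀ t ≥ (0:ℝ),
    HasDerivWithinAt (fun s => x s i)
      ((∑ j ∈ D.Nb t i, D.A i j (x t) (y t) t • (x t j - x t i)) +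
        (∑ j ∈ D.Ld t i, D.B i j (x t) (y t) t • (y t j - x t i)) + w i t)
      (Set.Ici t) t
  r_int : ∀ a b : ℝ, IntervalIntegrable (fun t => ⨆ j : Fin k, ‖u j (y t) t‖)
    MeasureTheory.volume a b
  q_int : ∀ a b : ℝ, IntervalIntegrable
    (fun t => (⨆ j : Fin k, ‖u j (y t) t‖) + ⨆ i : Fin n, ‖w i t‖)
    MeasureTheory.volume a b
  z_int : ∀ a b : ℝ, IntervalIntegrable
    (fun t => Real.sqrt ((∑ j : Fin k, ‖u j (y t) t‖ ^ 2) + ∑ i : Fin n, ‖w i t‖ ^ 2))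
    MeasureTheory.volume a b

namespace MASSol

variable {d n k : ℕ} {D : MASData d n k}

/-- The moving multi-leader set `ℒ(y(t))`: the convex hull of the leaders. -/
def Lset (sol : MASSol D) (t : ℝ) : Set (EuclideanSpace ℝ (Fin d)) :=
  convexHull ℝ (Set.range (sol.y t))

/-- `|x(t)|_{ℒ(y(t))}`: the maximal distance of the followers from `ℒ(y(t))`. -/
def distL (sol : MASSol D) (t : ℝ) : ℝ :=
  ⨆ i : Fin n, Metric.infDist (sol.x t i) (sol.Lset t)

/-- `r(t) = max_j |u_j(y(t),t)|`. -/
def rmax (sol : MASSol D) (t : ℝ) : ℝ := ⨆ j : Fin k, ‖sol.u j (sol.y t) t‖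

/-- `q(t) = max_j |u_j(y(t),t)| + max_i |w_i(t)|`. -/
def qmax (sol : MASSol D) (t : ℝ) : ℝ := sol.rmax t + ⨆ i : Fin n, ‖sol.w i t‖

/-- `|z(t)|`: the Euclidean norm of the combined input `z = (u, w)` at time `t`. -/
def znorm (sol : MASSol D) (t : ℝ) : ℝ :=
  Real.sqrt ((∑ j : Fin k, ‖sol.u j (sol.y t) t‖ ^ 2) + ∑ i : Fin n, ‖sol.w i t‖ ^ 2)

/-- `‖z‖_∞ = sup_{t ≥ 0} |z(t)|`. -/
def zsup (sol : MASSol D) : ℝ := sSup (sol.znorm '' Set.Ici 0)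

/-- The combined input `z` is (essentially) bounded, i.e. `z ∈ L_∞`. -/
def zBounded (sol : MASSol D) : Prop := BddAbove (sol.znorm '' Set.Ici 0)

end MASSol

/-- Class-𝒦 function on `[0,∞)`. -/
def IsClassK (γ : ℝ → ℝ) : Prop :=
  ContinuousOn γ (Set.Ici 0) ∧ StrictMonoOn γ (Set.Ici 0) ∧ γ 0 = 0

/-- Class-𝒦𝓛 function. -/
def IsClassKL (β : ℝ → ℝ → ℝ) : Prop :=
  (∀ t ≥ (0:ℝ), IsClassK fun s => β s t) ∧
  (∀ s ≥ (0:ℝ), AntitoneOn (fun t => β s t) (Set.Ici 0) ∧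
    Filter.Tendsto (fun t => β s t) Filter.atTop (nhds 0))

/-- System (5) is (generalized) set input-to-state stable with respect to
`ℒ(y(t))` with input `z`. -/
def MASData.SISS {d n k : ℕ} (D : MASData d n k) : Prop :=
  ∃ β γ, IsClassKL β ∧ IsClassK γ ∧
    ∀ sol : MASSol D, sol.zBounded →
      ∀ t ≥ (0:ℝ), sol.distL t ≤ β (sol.distL 0) t + γ sol.zsup

/-- System (5) is (generalized) set integral-input-to-state stable with respect
to `ℒ(y(t))`. -/
def MASData.SiISS {d n k : ℕ} (D : MASData d n k) : Prop :=
  ∃ β γ, IsClassKL β ∧ IsClassK γ ∧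
    ∀ sol : MASSol D, ∀ t ≥ (0:ℝ),
      sol.distL t ≤ β (sol.distL 0) t + ∫ s in (0:ℝ)..t, γ (sol.znorm s)

/-- The upper Dini derivative `D⁺h(t) = limsup_{s→0⁺} (h(t+s) − h(t))/s`. -/
def upperDini (h : ℝ → ℝ) (t : ℝ) : ℝ :=
  Filter.limsup (fun s => (h (t + s) - h t) / s) (nhdsWithin 0 (Set.Ioi 0))

theorem Convex.convexOn_infDist {E : Type*} [NormedAddCommGroup E] [NormedSpace ℝ E] {K : Set E}
    (hK : Convex ℝ K) (hne : K.Nonempty) : ConvexOn ℝ univ fun p => infDist p K := by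
  refine ⟨convex_univ, fun p _ q _ a b ha hb hab => le_of_forall_pos_le_add fun ε hε => ?_⟩
  obtain ⟨p', hp', hpp'⟩ := (infDist_lt_iff hne).1 (lt_add_of_pos_right (infDist p K) hε)
  obtain ⟨q', hq', hqq'⟩ := (infDist_lt_iff hne).1 (lt_add_of_pos_right (infDist q K) hε)
  calc infDist (a • p + b • q) K
      ≤ dist (a • p + b • q) (a • p' + b • q') := infDist_le_dist_of_mem (hK hp' hq' ha hb hab)
    _ ≤ dist (a • p) (a • p') + dist (b • q) (b • q') := dist_add_add_le _ _ _ _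
    _ = a * dist p p' + b * dist q q' := by
        simp [dist_smul₀, abs_of_nonneg ha, abs_of_nonneg hb]
    _ ≤ a * (infDist p K + ε) + b * (infDist q K + ε) := by gcongr
    _ = a • infDist p K + b • infDist q K + ε := by
        simp only [smul_eq_mul]; linear_combination ε * hab

theorem infDist_convexHull_range_le_add {E ι : Type*} [NormedAddCommGroup E] [NormedSpace ℝ E]
    [Nonempty ι] {v v' : ι → E} {ρ : ℝ} (h : ∀ j, dist (v j) (v' j) ≤ ρ) (p : E) :
    infDist p (convexHull ℝ (range v')) ≤ infDist p (convexHull ℝ (range v)) + ρ := by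
  have hne : (convexHull ℝ (range v)).Nonempty := (range_nonempty v).convexHull
  have hne' : (convexHull ℝ (range v')).Nonempty := (range_nonempty v').convexHull
  have hsub : convexHull ℝ (range v) ⊆ {q ∈ univ | infDist q (convexHull ℝ (range v')) ≤ ρ} := by
    refine convexHull_min ?_ (((convex_convexHull ℝ _).convexOn_infDist hne').convex_le ρ)
    rintro _ ⟨j, rfl⟩
    exact ⟨mem_univ _, (infDist_le_dist_of_mem (subset_convexHull ℝ _ (mem_range_self j))).trans
      (h j)⟩
  rw [← sub_le_iff_le_add, le_infDist hne]
  intro q hq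
  linarith [(hsub hq).2, infDist_le_infDist_add_dist (x := p) (y := q)
    (s := convexHull ℝ (range v'))]

theorem continuous_infDist_convexHull_range {E ι X : Type*} [NormedAddCommGroup E]
    [NormedSpace ℝ E] [Fintype ι] [Nonempty ι] [TopologicalSpace X] {f : X → E} {v : X → ι → E}
    (hf : Continuous f) (hv : ∀ j, Continuous fun t => v t j) :
    Continuous fun t => infDist (f t) (convexHull ℝ (range (v t))) := by
  have hlip : LipschitzWith 2 fun q : E × (ι → E) => infDist q.1 (convexHull ℝ (range q.2)) := by
    refine LipschitzWith.of_le_add_mul 2 fun q q' => ?_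
    have h₁ : dist q.1 q'.1 ≤ dist q q' := by rw [Prod.dist_eq]; exact le_max_left _ _
    have h₂ : dist q'.2 q.2 ≤ dist q q' := by
      rw [dist_comm, Prod.dist_eq]; exact le_max_right _ _
    have h₃ := infDist_convexHull_range_le_add (v := q'.2) (v' := q.2)
      (fun j => (dist_le_pi_dist _ _ j).trans h₂) q.1
    have h₄ := infDist_le_infDist_add_dist (x := q.1) (y := q'.1)
      (s := convexHull ℝ (range q'.2))
    rw [NNReal.coe_ofNat]
    linarith
  simpa only [Function.comp_def] using hlip.continuous.comp (hf.prodMk (continuous_pi hv))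

theorem ConvexOn.map_add_smul_sum_sub_le {E ι : Type*} [AddCommGroup E] [Module ℝ E] {g : E → ℝ}
    (hg : ConvexOn ℝ univ g) (S : Finset ι) {α : ι → ℝ} (hα : ∀ l ∈ S, 0 ≤ α l) (p : ι → E) (q : E)
    {h : ℝ} (h₀ : 0 ≤ h) (h₁ : h * ∑ l ∈ S, α l ≤ 1) :
    g (q + h • ∑ l ∈ S, α l • (p l - q)) ≤ g q + h * ∑ l ∈ S, α l * (g (p l) - g q) := by
  have key := hg.map_add_sum_le (t := S) (w := fun l => h * α l) (v := 1 - h * ∑ l ∈ S, α l)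
    (p := p) (q := q) (fun l hl => mul_nonneg h₀ (hα l hl)) (by rw [← Finset.mul_sum]; ring)
    (fun _ _ => mem_univ _) (sub_nonneg.2 h₁) (mem_univ _)
  have hl : (1 - h * ∑ l ∈ S, α l) • q + ∑ l ∈ S, (h * α l) • p l =
      q + h • ∑ l ∈ S, α l • (p l - q) := by
    simp only [smul_sub, mul_smul, ← Finset.smul_sum, Finset.sum_sub_distrib, ← Finset.sum_smul,
      sub_smul, one_smul]
    abel
  have hr : (1 - h * ∑ l ∈ S, α l) • g q + ∑ l ∈ S, (h * α l) • g (p l) =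
      g q + h * ∑ l ∈ S, α l * (g (p l) - g q) := by
    simp only [smul_eq_mul, mul_sub, mul_assoc, ← Finset.mul_sum, Finset.sum_sub_distrib,
      ← Finset.sum_mul]
    ring
  rwa [hl, hr] at key

theorem eventually_infDist_le_of_hasDerivWithinAt {E ι : Type*} [NormedAddCommGroup E]
    [NormedSpace ℝ E] {K : Set E} (hK : Convex ℝ K) (hne : K.Nonempty) (S : Finset ι) {α : ι → ℝ}
    (hα : ∀ l ∈ S, 0 ≤ α l) (p : ι → E) {f : ℝ → E} {w : E} {t : ℝ}
    (hf : HasDerivWithinAt f ((∑ l ∈ S, α l • (p l - f t)) + w) (Ici t) t) {ε : ℝ} (hε : 0 < ε) :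
    ∀ᶠ s in nhdsWithin t (Ioi t), infDist (f s) K ≤ infDist (f t) K +
      (s - t) * ((∑ l ∈ S, α l * (infDist (p l) K - infDist (f t) K)) + ‖w‖ + ε) := by
  have hsmall : ∀ᶠ s in nhdsWithin t (Ioi t), (s - t) * ∑ l ∈ S, α l < 1 := by
    have : Tendsto (fun s => (s - t) * ∑ l ∈ S, α l) (nhds t) (nhds ((t - t) * ∑ l ∈ S, α l)) :=
      Continuous.tendsto (by fun_prop) t
    exact (this.mono_left nhdsWithin_le_nhds).eventually_lt_const (by simp)
  have hlin := (hasDerivWithinAt_iff_isLittleO.1 (hf.mono Ioi_subset_Ici_self)).def hε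
  filter_upwards [hsmall, hlin, self_mem_nhdsWithin] with s hs hl (hst : t < s)
  have h₀ : 0 ≤ s - t := sub_nonneg.2 hst.le
  have key := (hK.convexOn_infDist hne).map_add_smul_sum_sub_le S hα p (f t) h₀ hs.le
  have hd := infDist_le_infDist_add_dist (x := f s)
    (y := f t + (s - t) • ∑ l ∈ S, α l • (p l - f t)) (s := K)
  have hn : dist (f s) (f t + (s - t) • ∑ l ∈ S, α l • (p l - f t)) ≤
      ε * (s - t) + (s - t) * ‖w‖ := by
    rw [Real.norm_of_nonneg h₀] at hl
    have hw : ‖(s - t) • w‖ = (s - t) * ‖w‖ := by rw [norm_smul, Real.norm_of_nonneg h₀]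
    rw [dist_eq_norm, ← hw]
    refine le_trans (le_of_eq ?_) ((norm_add_le _ _).trans (add_le_add_left hl _))
    congr 1
    rw [smul_add]
    abel
  linarith

/-- Comparison principle for a finite family: the bound `ψ + R` has a right-differentiable part `ψ`
and a merely continuous part `R`. -/
theorem le_add_of_eventually_le_of_touching {ι : Type*} [Finite ι] {a b : ℝ} {f : ι → ℝ → ℝ}
    {ψ ψ' R : ℝ → ℝ} (hf : ∀ i, Continuous (f i)) (hψ : ∀ t, HasDerivAt ψ (ψ' t) t)
    (hR : ContinuousOn R (Icc a b)) (ha : ∀ i, f i a ≤ ψ a + R a)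
    (htouch : ∀ t ∈ Ico a b, ∀ i, (∀ j, f j t ≤ f i t) → ψ t + R t ≤ f i t → ∀ ε > 0,
      ∀ᶠ s in nhdsWithin t (Ioi t),
        f i s ≤ f i t + (R s - R t) + (s - t) * (ψ' t + ε)) :
    ∀ t ∈ Icc a b, ∀ i, f i t ≤ ψ t + R t := by
  have hψc : Continuous ψ := continuous_iff_continuousAt.2 fun t => (hψ t).continuousAt
  have main : ∀ ε > 0, ∀ t ∈ Icc a b, ∀ i, f i t ≤ ψ t + R t + ε * (t - a) := by
    intro ε hε
    have hB : ContinuousOn (fun t => ψ t + R t + ε * (t - a)) (Icc a b) := by fun_prop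
    have hclosed : IsClosed ({t | ∀ i, f i t ≤ ψ t + R t + ε * (t - a)} ∩ Icc a b) := by
      have : {t | ∀ i, f i t ≤ ψ t + R t + ε * (t - a)} ∩ Icc a b =
          Icc a b ∩ ⋂ i, {t ∈ Icc a b | f i t ≤ ψ t + R t + ε * (t - a)} := by
        ext t
        simp only [mem_inter_iff, mem_ofPred_eq, mem_iInter]
        exact ⟨fun h => ⟨h.2, fun i => ⟨h.2, h.1 i⟩⟩, fun h => ⟨fun i => (h.2 i).2, h.1⟩⟩
      rw [this]
      exact isClosed_Icc.inter (isClosed_iInter fun i =>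
        isClosed_Icc.isClosed_le (hf i).continuousOn hB)
    refine hclosed.Icc_subset_of_forall_mem_nhdsWithin (by simpa using ha) ?_
    rintro t ⟨hle, ht⟩
    refine eventually_all.2 fun i => ?_
    rcases (hle i).lt_or_eq with hlt | heq
    · have hB' : Tendsto (fun s => ψ s + R s + ε * (s - a)) (nhdsWithin t (Ioi t))
          (nhds (ψ t + R t + ε * (t - a))) :=
        (hB t (Ico_subset_Icc_self ht)).mono_left (nhdsWithin_le_of_mem
          (mem_of_superset (Ioo_mem_nhdsGT ht.2) fun s hs =>
            ⟨ht.1.trans hs.1.le, hs.2.le⟩))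
      exact ((((hf i).tendsto t).mono_left nhdsWithin_le_nhds).eventually_lt hB' hlt).mono
        fun s hs => hs.le
    · have h₁ := htouch t ht i (fun j => (hle j).trans_eq heq.symm)
        (by rw [heq]; linarith [mul_nonneg hε.le (sub_nonneg.2 ht.1)]) (ε / 2) (half_pos hε)
      have h₂ := (hasDerivWithinAt_iff_isLittleO.1
        ((hψ t).hasDerivWithinAt (s := Ioi t))).def (half_pos hε)
      filter_upwards [h₁, h₂, self_mem_nhdsWithin] with s h₁ h₂ (hst : t < s)
      rw [Real.norm_of_nonneg (sub_nonneg.2 hst.le), Real.norm_eq_abs, smul_eq_mul] at h₂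
      have := (abs_le.1 h₂).1
      linarith
  intro t ht i
  have hlim : Tendsto (fun ε => ψ t + R t + ε * (t - a)) (nhdsWithin 0 (Ioi 0))
      (nhds (ψ t + R t)) := by
    have : Tendsto (fun ε => ψ t + R t + ε * (t - a)) (nhds 0) (nhds (ψ t + R t + 0 * (t - a))) :=
      Continuous.tendsto (by fun_prop) 0
    simpa using this.mono_left nhdsWithin_le_nhds
  exact ge_of_tendsto hlim (eventually_mem_nhdsWithin.mono fun ε hε => main ε hε t ht i)

theorem norm_sub_le_integral_of_hasDerivWithinAt_Ici {E : Type*} [NormedAddCommGroup E]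
    [NormedSpace ℝ E] [CompleteSpace E] {f f' : ℝ → E} {r : ℝ → ℝ}
    {a b : ℝ} (hab : a ≤ b) (hf : Continuous f)
    (hderiv : ∀ t ≥ a, HasDerivWithinAt f (f' t) (Ici t) t) (hle : ∀ t ≥ a, ‖f' t‖ ≤ r t)
    (hr : IntervalIntegrable r volume a b) : ‖f b - f a‖ ≤ ∫ t in a..b, r t := by
  have hint : IntervalIntegrable f' volume a b := by
    refine hr.mono_fun ?_ ?_
    · refine ((aestronglyMeasurable_derivWithin_Ici f volume).restrict
        (s := uIoc a b)).congr ?_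
      filter_upwards [ae_restrict_mem measurableSet_uIoc] with t ht
      rw [uIoc_of_le hab] at ht
      exact (hderiv t ht.1.le).derivWithin (uniqueDiffWithinAt_Ici t)
    · filter_upwards [ae_restrict_mem measurableSet_uIoc] with t ht
      rw [uIoc_of_le hab] at ht
      exact (hle t ht.1.le).trans (Real.le_norm_self _)
  rw [← intervalIntegral.integral_eq_sub_of_hasDeriv_right_of_le hab hf.continuousOn
    (fun t ht => (hderiv t ht.1.le).mono Ioi_subset_Ici_self) hint]
  exact intervalIntegral.norm_integral_le_of_norm_le hab
    (ae_of_all _ fun t ht => hle t ht.1.le) hr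

namespace MASSol

variable {d n k : ℕ} {D : MASData d n k}

/-- The Euclidean norm of the combined disturbance `w`. -/
def wnorm (sol : MASSol D) (t : ℝ) : ℝ := Real.sqrt (∑ i : Fin n, ‖sol.w i t‖ ^ 2)

theorem continuous_wnorm (sol : MASSol D) : Continuous sol.wnorm :=
  Real.continuous_sqrt.comp
    (continuous_finsetSum _ fun i _ => (sol.w_cont i).norm.pow 2)

theorem wnorm_nonneg (sol : MASSol D) (t : ℝ) : 0 ≤ sol.wnorm t := Real.sqrt_nonneg _

theorem norm_w_le_wnorm (sol : MASSol D) (i : Fin n) (t : ℝ) : ‖sol.w i t‖ ≤ sol.wnorm t :=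
  Real.le_sqrt_of_sq_le (Finset.single_le_sum (f := fun i => ‖sol.w i t‖ ^ 2)
    (fun _ _ => sq_nonneg _) (Finset.mem_univ i))

theorem norm_u_le_rmax (sol : MASSol D) (j : Fin k) (t : ℝ) :
    ‖sol.u j (sol.y t) t‖ ≤ sol.rmax t :=
  le_ciSup (f := fun j => ‖sol.u j (sol.y t) t‖) (Set.finite_range _).bddAbove j

theorem rmax_nonneg (sol : MASSol D) (t : ℝ) : 0 ≤ sol.rmax t :=
  Real.iSup_nonneg fun _ => norm_nonneg _

theorem rmax_add_wnorm_le (sol : MASSol D) (t : ℝ) :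
    sol.rmax t + sol.wnorm t ≤ Real.sqrt 2 * sol.znorm t := by
  have hu : 0 ≤ ∑ j : Fin k, ‖sol.u j (sol.y t) t‖ ^ 2 := by positivity
  have hw : 0 ≤ ∑ i : Fin n, ‖sol.w i t‖ ^ 2 := by positivity
  have hr : sol.rmax t ≤ Real.sqrt (∑ j : Fin k, ‖sol.u j (sol.y t) t‖ ^ 2) :=
    Real.iSup_le (fun j => Real.le_sqrt_of_sq_le
      (Finset.single_le_sum (f := fun j => ‖sol.u j (sol.y t) t‖ ^ 2)
        (fun _ _ => sq_nonneg _) (Finset.mem_univ j))) (Real.sqrt_nonneg _)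
  refine (add_le_add_left hr _).trans ?_
  rw [znorm, ← Real.sqrt_mul zero_le_two]
  refine Real.le_sqrt_of_sq_le ?_
  rw [wnorm]
  nlinarith [sq_nonneg (Real.sqrt (∑ j : Fin k, ‖sol.u j (sol.y t) t‖ ^ 2) -
    Real.sqrt (∑ i : Fin n, ‖sol.w i t‖ ^ 2)), Real.sq_sqrt hu, Real.sq_sqrt hw]

theorem integral_rmax_add_integral_wnorm_le (sol : MASSol D) {a b : ℝ} (hab : a ≤ b) :
    (∫ s in a..b, sol.rmax s) + ∫ s in a..b, sol.wnorm s ≤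
      Real.sqrt 2 * ∫ s in a..b, sol.znorm s := by
  have hr : IntervalIntegrable sol.rmax volume a b := sol.r_int a b
  rw [← intervalIntegral.integral_add hr (sol.continuous_wnorm.intervalIntegrable a b),
    ← intervalIntegral.integral_const_mul]
  exact intervalIntegral.integral_mono_on hab
    (hr.add (sol.continuous_wnorm.intervalIntegrable a b))
    ((sol.z_int a b).const_mul _) fun t _ => sol.rmax_add_wnorm_le t

theorem nonempty_Lset (sol : MASSol D) (t : ℝ) : (sol.Lset t).Nonempty :=
  have : Nonempty (Fin k) := ⟨⟨0, D.hk⟩⟩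
  (range_nonempty _).convexHull

theorem continuous_infDist_Lset (sol : MASSol D) (i : Fin n) :
    Continuous fun t => infDist (sol.x t i) (sol.Lset t) :=
  have : Nonempty (Fin k) := ⟨⟨0, D.hk⟩⟩
  continuous_infDist_convexHull_range (sol.x_cont i) sol.y_cont

theorem infDist_Lset_le_distL (sol : MASSol D) (i : Fin n) (t : ℝ) :
    infDist (sol.x t i) (sol.Lset t) ≤ sol.distL t :=
  le_ciSup (f := fun i => infDist (sol.x t i) (sol.Lset t)) (Set.finite_range _).bddAbove i

theorem infDist_Lset_le_add_integral_rmax (sol : MASSol D) {t s : ℝ} (ht : 0 ≤ t) (hts : t ≤ s)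
    (p : EuclideanSpace ℝ (Fin d)) :
    infDist p (sol.Lset s) ≤ infDist p (sol.Lset t) + ∫ τ in t..s, sol.rmax τ := by
  have : Nonempty (Fin k) := ⟨⟨0, D.hk⟩⟩
  refine infDist_convexHull_range_le_add (fun j => ?_) p
  rw [dist_comm, dist_eq_norm]
  exact norm_sub_le_integral_of_hasDerivWithinAt_Ici hts (sol.y_cont j)
    (fun τ hτ => sol.dyn_y j τ (ht.trans hτ)) (fun τ _ => sol.norm_u_le_rmax j τ) (sol.r_int t s)

theorem eventually_infDist_Lset_le (sol : MASSol D) (i : Fin n) {t : ℝ} (ht : 0 ≤ t) {ε : ℝ}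
    (hε : 0 < ε) :
    ∀ᶠ s in nhdsWithin t (Ioi t), infDist (sol.x s i) (sol.Lset s) ≤
      infDist (sol.x t i) (sol.Lset t) + (∫ τ in t..s, sol.rmax τ) +
        (s - t) * ((∑ j ∈ D.Nb t i, D.A i j (sol.x t) (sol.y t) t *
            (infDist (sol.x t j) (sol.Lset t) - infDist (sol.x t i) (sol.Lset t))) -
          (∑ j ∈ D.Ld t i, D.B i j (sol.x t) (sol.y t) t) *
            infDist (sol.x t i) (sol.Lset t) + sol.wnorm t + ε) := by
  have hy : ∀ j, infDist (sol.y t j) (sol.Lset t) = 0 := fun j =>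
    infDist_zero_of_mem (subset_convexHull ℝ _ (mem_range_self j))
  have key := eventually_infDist_le_of_hasDerivWithinAt (K := sol.Lset t) (convex_convexHull ℝ _)
    (sol.nonempty_Lset t) ((D.Nb t i).disjSum (D.Ld t i))
    (α := Sum.elim (fun j => D.A i j (sol.x t) (sol.y t) t) fun j => D.B i j (sol.x t) (sol.y t) t)
    (fun l _ => Sum.rec (fun j => (D.aLo_pos.trans_le (D.A_bdd i j _ _ t).1).le)
      (fun j => (D.bLo_pos.trans_le (D.B_bdd i j _ _ t)).le) l)
    (Sum.elim (sol.x t) (sol.y t)) (f := fun s => sol.x s i) (w := sol.w i t) (t := t)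
    (by simpa only [Finset.sum_disjSum, Sum.elim_inl, Sum.elim_inr] using sol.dyn_x i t ht) hε
  filter_upwards [key, self_mem_nhdsWithin] with s hs (hst : t < s)
  simp only [Finset.sum_disjSum, Sum.elim_inl, Sum.elim_inr, hy, zero_sub, mul_neg,
    Finset.sum_neg_distrib, ← Finset.sum_mul] at hs
  have h₁ := sol.infDist_Lset_le_add_integral_rmax ht hst.le (sol.x s i)
  have h₂ := mul_le_mul_of_nonneg_left (sol.norm_w_le_wnorm i t) (sub_nonneg.2 hst.le)
  linarith

theorem hasDerivAt_integral_wnorm (sol : MASSol D) (a t : ℝ) :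
    HasDerivAt (fun t => ∫ s in a..t, sol.wnorm s) (sol.wnorm t) t :=
  sol.continuous_wnorm.integral_hasStrictDerivAt a t |>.hasDerivAt

theorem continuousOn_integral_rmax (sol : MASSol D) (a b : ℝ) :
    ContinuousOn (fun t => ∫ s in a..t, sol.rmax s) (Icc a b) :=
  (intervalIntegral.continuous_primitive sol.r_int a).continuousOn

theorem integral_rmax_sub (sol : MASSol D) (a t s : ℝ) :
    (∫ τ in a..s, sol.rmax τ) - (∫ τ in a..t, sol.rmax τ) = ∫ τ in t..s, sol.rmax τ :=
  intervalIntegral.integral_interval_sub_left (sol.r_int a s) (sol.r_int a t)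

theorem infDist_Lset_le_distL_add_integral (sol : MASSol D) {a : ℝ} (ha : 0 ≤ a) {t : ℝ}
    (hat : a ≤ t) (i : Fin n) :
    infDist (sol.x t i) (sol.Lset t) ≤
      sol.distL a + (∫ s in a..t, sol.wnorm s) + ∫ s in a..t, sol.rmax s := by
  refine le_add_of_eventually_le_of_touching
    (f := fun i t => infDist (sol.x t i) (sol.Lset t)) sol.continuous_infDist_Lset
    (ψ := fun t => sol.distL a + ∫ s in a..t, sol.wnorm s)
    (fun t => (sol.hasDerivAt_integral_wnorm a t).const_add _)
    (sol.continuousOn_integral_rmax a t)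
    (fun i => by simpa using sol.infDist_Lset_le_distL i a) ?_ t (right_mem_Icc.2 hat) i
  intro t ht i hmax _ ε hε
  filter_upwards [sol.eventually_infDist_Lset_le i (ha.trans ht.1) hε, self_mem_nhdsWithin]
    with s hs (hst : t < s)
  rw [integral_rmax_sub]
  refine hs.trans ?_
  have hA : ∑ j ∈ D.Nb t i, D.A i j (sol.x t) (sol.y t) t *
      (infDist (sol.x t j) (sol.Lset t) - infDist (sol.x t i) (sol.Lset t)) ≤ 0 :=
    Finset.sum_nonpos fun j _ => mul_nonpos_of_nonneg_of_nonpos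
      (D.aLo_pos.trans_le (D.A_bdd i j _ _ t).1).le (sub_nonpos.2 (hmax j))
  have hB : 0 ≤ (∑ j ∈ D.Ld t i, D.B i j (sol.x t) (sol.y t) t) *
      infDist (sol.x t i) (sol.Lset t) :=
    mul_nonneg (Finset.sum_nonneg fun j _ => (D.bLo_pos.trans_le (D.B_bdd i j _ _ t)).le)
      infDist_nonneg
  have hst' := sub_nonneg.2 hst.le
  refine add_le_add le_rfl (mul_le_mul_of_nonneg_left ?_ hst')
  linarith

/-- Under a leader arc the distance of follower `i` contracts relative to any common bound `m`. -/
theorem infDist_Lset_le_of_leader_arc (sol : MASSol D) {a b m : ℝ} (ha : 0 ≤ a) {i : Fin n}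
    {j : Fin k} (harc : ∀ t ∈ Ico a b, j ∈ D.Ld t i)
    (hm : ∀ t ∈ Icc a b, ∀ l, infDist (sol.x t l) (sol.Lset t) ≤ m) {lam : ℝ}
    (hlam : lam = D.bLo + ((n : ℝ) - 1) * D.aHi) (hlam₀ : 0 < lam) {t : ℝ} (ht : t ∈ Icc a b) :
    infDist (sol.x t i) (sol.Lset t) ≤
      sol.distL a * Real.exp (-lam * (t - a)) +
        ((n : ℝ) - 1) * D.aHi * m / lam * (1 - Real.exp (-lam * (t - a))) +
        (∫ s in a..t, sol.wnorm s) + ∫ s in a..t, sol.rmax s := by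
  set c := ((n : ℝ) - 1) * D.aHi with hc
  set φ : ℝ → ℝ := fun t => sol.distL a * Real.exp (-lam * (t - a)) +
    c * m / lam * (1 - Real.exp (-lam * (t - a))) with hφ
  have hφd : ∀ t, HasDerivAt φ (c * m - lam * φ t) t := by
    intro t
    have he : HasDerivAt (fun t => Real.exp (-lam * (t - a)))
        (Real.exp (-lam * (t - a)) * (-lam * 1)) t :=
      (((hasDerivAt_id t).sub_const a).const_mul (-lam)).exp
    refine ((he.const_mul (sol.distL a)).add
      ((he.const_sub 1).const_mul (c * m / lam))).congr_deriv ?_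
    simp only [hφ]
    field_simp
    ring
  refine le_add_of_eventually_le_of_touching (ι := Unit)
    (f := fun _ t => infDist (sol.x t i) (sol.Lset t)) (fun _ => sol.continuous_infDist_Lset i)
    (ψ := fun t => φ t + ∫ s in a..t, sol.wnorm s)
    (fun t => (hφd t).add (sol.hasDerivAt_integral_wnorm a t))
    (sol.continuousOn_integral_rmax a b)
    (fun _ => by simpa [hφ] using sol.infDist_Lset_le_distL i a) ?_ t ht ()
  intro t ht _ _ hge ε hε
  filter_upwards [sol.eventually_infDist_Lset_le i (ha.trans ht.1) hε, self_mem_nhdsWithin]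
    with s hs (hst : t < s)
  rw [integral_rmax_sub]
  refine hs.trans ?_
  have hmi := hm t (Ico_subset_Icc_self ht)
  have hA : ∑ l ∈ D.Nb t i, D.A i l (sol.x t) (sol.y t) t *
      (infDist (sol.x t l) (sol.Lset t) - infDist (sol.x t i) (sol.Lset t)) ≤
      c * (m - infDist (sol.x t i) (sol.Lset t)) := by
    have hpos : ∀ l, 0 ≤ D.A i l (sol.x t) (sol.y t) t := fun l =>
      (D.aLo_pos.trans_le (D.A_bdd i l _ _ t).1).le
    have hgap := sub_nonneg.2 (hmi i)
    rw [← Finset.sum_erase (a := i) _ (by simp)]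
    calc _ ≤ ∑ l ∈ (D.Nb t i).erase i, D.aHi * (m - infDist (sol.x t i) (sol.Lset t)) := by
          refine Finset.sum_le_sum fun l _ => ?_
          calc _ ≤ D.A i l (sol.x t) (sol.y t) t * (m - infDist (sol.x t i) (sol.Lset t)) :=
                mul_le_mul_of_nonneg_left (sub_le_sub_right (hmi l) _) (hpos l)
            _ ≤ _ := mul_le_mul_of_nonneg_right (D.A_bdd i l _ _ t).2 hgap
      _ ≤ ∑ l ∈ Finset.univ.erase i, D.aHi * (m - infDist (sol.x t i) (sol.Lset t)) :=
          Finset.sum_le_sum_of_subset_of_nonneg (Finset.erase_subset_erase _ (Finset.subset_univ _))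
            fun l _ _ => mul_nonneg ((hpos l).trans (D.A_bdd i l _ _ t).2) hgap
      _ = _ := by
          rw [Finset.sum_const, Finset.card_erase_of_mem (Finset.mem_univ i), Finset.card_univ,
            Fintype.card_fin, nsmul_eq_mul, Nat.cast_sub (one_le_two.trans D.hn), Nat.cast_one,
            hc, mul_assoc]
  have hB : D.bLo * infDist (sol.x t i) (sol.Lset t) ≤
      (∑ l ∈ D.Ld t i, D.B i l (sol.x t) (sol.y t) t) * infDist (sol.x t i) (sol.Lset t) := by
    refine mul_le_mul_of_nonneg_right ?_ infDist_nonneg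
    exact (D.B_bdd i j _ _ t).trans (Finset.single_le_sum
      (f := fun l => D.B i l (sol.x t) (sol.y t) t)
      (fun l _ => (D.bLo_pos.trans_le (D.B_bdd i l _ _ t)).le) (harc t ht))
  have hφle : φ t ≤ infDist (sol.x t i) (sol.Lset t) := by
    have hW := intervalIntegral.integral_nonneg (μ := volume) ht.1 fun s _ => sol.wnorm_nonneg s
    have hR := intervalIntegral.integral_nonneg (μ := volume) ht.1 fun s _ => sol.rmax_nonneg s
    linarith
  have hst' := sub_nonneg.2 hst.le
  have hlamφ := mul_le_mul_of_nonneg_left hφle hlam₀.le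
  have hsplit : lam * infDist (sol.x t i) (sol.Lset t) =
      D.bLo * infDist (sol.x t i) (sol.Lset t) + c * infDist (sol.x t i) (sol.Lset t) := by
    rw [hlam, add_mul]
  refine add_le_add le_rfl (mul_le_mul_of_nonneg_left ?_ hst')
  linarith

end MASSol

/-- **Lemma 11.**  If there is an arc `(j, i)` from leader `j` into follower `i`
present in `G_{σ(t)}` for all `t ∈ [t₀, t₀ + τ_D)`, then with
`λ = b_* + (n−1)a^*` and `δ(s) = (b_* e^{−λs} + (n−1)a^*)/λ` — a strictly
decreasing function from `[0, τ_D]` into `(0,1]` with `δ(0) = 1` — one has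
`dist(x_i(t), ℒ(y(t))) ≤ δ(t−t₀)·|x(t₀)|_{ℒ(y(t₀))} + 2√2 ∫_{t₀}^{t₀+τ_D} |z(s)| ds`
for all `t ∈ [t₀, t₀ + τ_D]`. -/
theorem lemma11_leader_arc_integral {d n k : ℕ} (D : MASData d n k) (sol : MASSol D)
    (t₀ : ℝ) (ht₀ : 0 ≤ t₀) (i : Fin n) (j : Fin k)
    (harc : ∀ t ∈ Set.Ico t₀ (t₀ + D.τD), j ∈ D.Ld t i) :
    let lam : ℝ := D.bLo + ((n:ℝ) - 1) * D.aHi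
    let δ : ℝ → ℝ := fun s => (D.bLo * Real.exp (-lam * s) + ((n:ℝ) - 1) * D.aHi) / lam
    StrictAntiOn δ (Set.Icc 0 D.τD) ∧ δ 0 = 1 ∧
    (∀ s ∈ Set.Icc (0:ℝ) D.τD, 0 < δ s ∧ δ s ≤ 1) ∧
    ∀ t ∈ Set.Icc t₀ (t₀ + D.τD),
      Metric.infDist (sol.x t i) (sol.Lset t) ≤
        δ (t - t₀) * sol.distL t₀ +
          2 * Real.sqrt 2 * ∫ s in t₀..(t₀ + D.τD), sol.znorm s := by
  intro lam δ
  have hn : (1 : ℝ) < n := by exact_mod_cast D.hn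
  have haHi : 0 < D.aHi :=
    D.aLo_pos.trans_le ((D.A_bdd i i 0 0 0).1.trans (D.A_bdd i i 0 0 0).2)
  have hc : 0 < ((n : ℝ) - 1) * D.aHi := mul_pos (sub_pos.2 hn) haHi
  have hlam : 0 < lam := add_pos D.bLo_pos hc
  have hδ : StrictAnti δ := by
    intro s s' hss'
    have hexp : Real.exp (-lam * s') < Real.exp (-lam * s) :=
      Real.exp_lt_exp.2 (mul_lt_mul_of_neg_left hss' (neg_lt_zero.2 hlam))
    exact div_lt_div_of_pos_right
      (add_lt_add_left (mul_lt_mul_of_pos_left hexp D.bLo_pos) _) hlam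
  have hδ₀ : δ 0 = 1 := by
    simp only [δ, mul_zero, Real.exp_zero, mul_one]
    exact div_self hlam.ne'
  refine ⟨hδ.strictAntiOn _, hδ₀, fun s hs => ⟨?_, hδ₀ ▸ hδ.antitone hs.1⟩, fun t ht => ?_⟩
  · exact div_pos (add_pos (mul_pos D.bLo_pos (Real.exp_pos _)) hc) hlam
  have hT : t₀ ≤ t₀ + D.τD := le_add_of_nonneg_right D.τD_pos.le
  set Q := (∫ s in t₀..(t₀ + D.τD), sol.rmax s) + ∫ s in t₀..(t₀ + D.τD), sol.wnorm s with hQ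
  have hQle : ∀ s ∈ Icc t₀ (t₀ + D.τD),
      (∫ τ in t₀..s, sol.rmax τ) + (∫ τ in t₀..s, sol.wnorm τ) ≤ Q := fun s hs =>
    add_le_add
      (intervalIntegral.integral_mono_interval le_rfl hs.1 hs.2
        (Eventually.of_forall sol.rmax_nonneg) (sol.r_int _ _))
      (intervalIntegral.integral_mono_interval le_rfl hs.1 hs.2
        (Eventually.of_forall sol.wnorm_nonneg) (sol.continuous_wnorm.intervalIntegrable _ _))
  have hQ₀ : 0 ≤ Q := by simpa using hQle t₀ (left_mem_Icc.2 hT)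
  have hm : ∀ s ∈ Icc t₀ (t₀ + D.τD), ∀ l,
      infDist (sol.x s l) (sol.Lset s) ≤ sol.distL t₀ + Q := fun s hs l => by
    linarith [sol.infDist_Lset_le_distL_add_integral ht₀ hs.1 l, hQle s hs]
  have key := sol.infDist_Lset_le_of_leader_arc ht₀ harc hm (lam := lam) rfl hlam ht
  have hz := sol.integral_rmax_add_integral_wnorm_le hT
  set e := Real.exp (-lam * (t - t₀)) with he
  have hsplit : sol.distL t₀ * e +
      ((n : ℝ) - 1) * D.aHi * (sol.distL t₀ + Q) / lam * (1 - e) =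
      δ (t - t₀) * sol.distL t₀ + ((n : ℝ) - 1) * D.aHi / lam * (1 - e) * Q := by
    simp only [δ, ← he]
    field_simp
    simp only [lam]
    ring
  have hfrac : ((n : ℝ) - 1) * D.aHi / lam * (1 - e) ≤ 1 := by
    refine mul_le_one₀ ((div_le_one hlam).2 (le_add_of_nonneg_left D.bLo_pos.le)) ?_ ?_
    · exact sub_nonneg.2 (Real.exp_le_one_iff.2
        (mul_nonpos_of_nonpos_of_nonneg (neg_nonpos.2 hlam.le) (sub_nonneg.2 ht.1)))
    · linarith [Real.exp_pos (-lam * (t - t₀))]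
  linarith [mul_le_mul_of_nonneg_right hfrac hQ₀, hQle t ht]
end
end

section
/- Let 𝒱_F^1 ⊆ 𝒱_F be a nonempty subset of followers and T̂ > 0. Suppose that during [t₁, t₁ + T̂) there are no arcs of G_{σ(t)} leaving 𝒱_F ∖ 𝒱_F^1 and entering 𝒱_F^1, and that dist(x_i(t₁), ℒ(y(t₁))) ≤ ε₀ |x(t₀)|_{ℒ(y(t₀))} + ĉ₀ for every i ∈ 𝒱_F^1, for constants ε₀ ∈ (0,1) and ĉ₀ > 0. Then for every i ∈ 𝒱_F^1 and every t ∈ [t₁, t₁ + T̂], dist(x_i(t), ℒ(y(t))) ≤ ε₀ |x(t₀)|_{ℒ(y(t₀))} + ĉ₀ + √2 ∫_{t₁}^{t} |z(s)| ds. -/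
open Metric Set Filter MeasureTheory

noncomputable section

open scoped Topology

/-- A continuous function whose upper right Dini derivative is bounded by an integrable function
grows by at most the integral of that function. -/
theorem sub_le_integral_of_eventually_sub_le {g φ : ℝ → ℝ} {a b : ℝ} (hab : a ≤ b)
    (hcont : ContinuousOn g (Icc a b)) (φint : IntegrableOn φ (Icc a b))
    (hg : ∀ t ∈ Ico a b, ∀ c, φ t < c → ∀ᶠ u in 𝓝[>] t, g u - g t ≤ (u - t) * c) :
    g b - g a ≤ ∫ y in a..b, φ y := by
  refine le_of_forall_pos_le_add fun ε εpos => ?_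
  rcases exists_lt_lowerSemicontinuous_integral_lt φ φint εpos with
    ⟨G, φ_lt_G, G_cont, G_int, G_lt_top, hG⟩
  set s := {t | g t - g a ≤ ∫ u in a..t, (G u).toReal} ∩ Icc a b
  have s_closed : IsClosed s := by
    have : ContinuousOn (fun t => (g t - g a, ∫ u in a..t, (G u).toReal)) (Icc a b) := by
      rw [← uIcc_of_le hab] at G_int hcont ⊢
      exact (hcont.sub continuousOn_const).prodMk
        (intervalIntegral.continuousOn_primitive_interval G_int)
    simp only [s, inter_comm]
    exact this.preimage_isClosed_of_isClosed isClosed_Icc OrderClosedTopology.isClosed_le'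
  have main : Icc a b ⊆ {t | g t - g a ≤ ∫ u in a..t, (G u).toReal} := by
    refine s_closed.Icc_subset_of_forall_exists_gt
      (by simp only [intervalIntegral.integral_same, mem_ofPred_eq, sub_self, le_rfl])
      fun t ht v t_lt_v => ?_
    obtain ⟨c, φ_lt_c, c_lt_G⟩ : ∃ c : ℝ, (φ t : EReal) < c ∧ (c : EReal) < G t :=
      EReal.lt_iff_exists_real_btwn.1 (φ_lt_G t)
    have I1 : ∀ᶠ u in 𝓝[>] t, (u - t) * c ≤ ∫ w in t..u, (G w).toReal := by
      have B : ∀ᶠ u in 𝓝 t, (c : EReal) < G u := G_cont.lowerSemicontinuousAt _ _ c_lt_G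
      rcases mem_nhds_iff_exists_Ioo_subset.1 B with ⟨m, M, ⟨hm, hM⟩, H⟩
      have : Ioo t (min M b) ∈ 𝓝[>] t := Ioo_mem_nhdsGT (lt_min hM ht.right.right)
      filter_upwards [this] with u hu
      have I : Icc t u ⊆ Icc a b := Icc_subset_Icc ht.2.1 (hu.2.le.trans (min_le_right _ _))
      calc
        (u - t) * c = ∫ _ in Icc t u, c := by
          simp only [MeasureTheory.integral_const, MeasurableSet.univ, measureReal_restrict_apply,
            univ_inter, hu.left.le, Real.volume_real_Icc_of_le, smul_eq_mul]
        _ ≤ ∫ w in t..u, (G w).toReal := by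
          rw [intervalIntegral.integral_of_le hu.1.le, ← integral_Icc_eq_integral_Ioc]
          apply setIntegral_mono_ae_restrict
          · simp
          · exact IntegrableOn.mono_set G_int I
          · have C1 : ∀ᵐ x : ℝ ∂volume.restrict (Icc t u), G x < ⊤ :=
              ae_mono (Measure.restrict_mono I le_rfl) G_lt_top
            have C2 : ∀ᵐ x : ℝ ∂volume.restrict (Icc t u), x ∈ Icc t u :=
              ae_restrict_mem measurableSet_Icc
            filter_upwards [C1, C2] with x hGx hx
            apply EReal.coe_le_coe_iff.1
            have : x ∈ Ioo m M := by
              simp only [hm.trans_le hx.left,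
                (hx.right.trans_lt hu.right).trans_le (min_le_left M b), mem_Ioo, and_self_iff]
            refine (H this).out.le.trans_eq ?_
            exact (EReal.coe_toReal hGx.ne (φ_lt_G x).ne_bot).symm
    have I2 : ∀ᶠ u in 𝓝[>] t, u ∈ Ioc t (min v b) := Ioc_mem_nhdsGT <| lt_min t_lt_v ht.2.2
    rcases ((I1.and (hg t ht.2 c (EReal.coe_lt_coe_iff.1 φ_lt_c))).and I2).exists with
      ⟨x, ⟨hx₁, hx₂⟩, hx⟩
    refine ⟨x, ?_, Ioc_subset_Ioc le_rfl (min_le_left _ _) hx⟩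
    calc
      g x - g a = g t - g a + (g x - g t) := by abel
      _ ≤ (∫ w in a..t, (G w).toReal) + ∫ w in t..x, (G w).toReal :=
        add_le_add ht.1 (hx₂.trans hx₁)
      _ = ∫ w in a..x, (G w).toReal := by
        apply intervalIntegral.integral_add_adjacent_intervals
        · rw [intervalIntegrable_iff_integrableOn_Ioc_of_le ht.2.1]
          exact IntegrableOn.mono_set G_int
            (Ioc_subset_Icc_self.trans (Icc_subset_Icc le_rfl ht.2.2.le))
        · rw [intervalIntegrable_iff_integrableOn_Ioc_of_le hx.1.le]
          apply IntegrableOn.mono_set G_int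
          exact Ioc_subset_Icc_self.trans (Icc_subset_Icc ht.2.1 (hx.2.trans (min_le_right _ _)))
  calc
    g b - g a ≤ ∫ y in a..b, (G y).toReal := main (right_mem_Icc.2 hab)
    _ ≤ (∫ y in a..b, φ y) + ε := by
      rw [intervalIntegral.integral_of_le hab, intervalIntegral.integral_of_le hab,
        ← integral_Icc_eq_integral_Ioc, ← integral_Icc_eq_integral_Ioc]
      exact hG.le

section Convexity

variable {E : Type*} [NormedAddCommGroup E] [NormedSpace ℝ E]

theorem Convex.setOf_infDist_le {s : Set E} (hs : Convex ℝ s) (hne : s.Nonempty) (M : ℝ) :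
    Convex ℝ {p | infDist p s ≤ M} := by
  rcases lt_or_ge M 0 with hM | hM
  · convert convex_empty (𝕜 := ℝ) (E := E)
    exact eq_empty_of_forall_notMem fun p hp => (hM.trans_le infDist_nonneg).not_ge hp
  · convert hs.cthickening M
    ext p
    rw [mem_cthickening_iff, ENNReal.le_ofReal_iff_toReal_le (infEDist_ne_top hne) hM]
    rfl

theorem infDist_convexHull_range_le_add_dist {ι : Type*} [Fintype ι] [Nonempty ι]
    (y y' : ι → E) (p : E) :
    infDist p (convexHull ℝ (range y')) ≤ infDist p (convexHull ℝ (range y)) + dist y y' := by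
  have hne (z : ι → E) : (convexHull ℝ (range z)).Nonempty := (range_nonempty z).convexHull
  have hsub : convexHull ℝ (range y) ⊆ {q | infDist q (convexHull ℝ (range y')) ≤ dist y y'} := by
    refine convexHull_min ?_ ((convex_convexHull ℝ _).setOf_infDist_le (hne y') _)
    rintro _ ⟨j, rfl⟩
    exact (infDist_le_dist_of_mem (subset_convexHull ℝ _ (mem_range_self j))).trans
      (dist_le_pi_dist y y' j)
  rw [← sub_le_iff_le_add]
  refine (le_infDist (hne y)).2 fun q hq => ?_
  have h₁ : infDist q (convexHull ℝ (range y')) ≤ dist y y' := hsub hq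
  have h₂ := infDist_le_infDist_add_dist (s := convexHull ℝ (range y')) (x := p) (y := q)
  linarith

theorem Convex.eventually_add_smul_smul_sub_mem {s : Set E} (hs : Convex ℝ s) {p q : E}
    (hp : p ∈ s) (hq : q ∈ s) {c : ℝ} (hc : 0 ≤ c) :
    ∀ᶠ δ : ℝ in 𝓝[>] 0, p + δ • c • (q - p) ∈ s := by
  have hlim : Tendsto (fun δ : ℝ => δ * c) (𝓝[>] 0) (𝓝 0) := by
    have : ContinuousAt (fun δ : ℝ => δ * c) 0 := by fun_prop
    simpa [ContinuousAt] using this.tendsto.mono_left (nhdsWithin_le_nhds (s := Ioi 0))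
  filter_upwards [hlim.eventually_le_const one_pos, self_mem_nhdsWithin] with δ h₁ h₀
  rw [smul_smul]
  exact hs.add_smul_sub_mem hp hq ⟨mul_nonneg (le_of_lt h₀) hc, h₁⟩

theorem Convex.eventually_add_smul_add_mem {s : Set E} (hs : Convex ℝ s) {p v w : E}
    (hv : ∀ᶠ δ : ℝ in 𝓝[>] 0, p + δ • v ∈ s) (hw : ∀ᶠ δ : ℝ in 𝓝[>] 0, p + δ • w ∈ s) :
    ∀ᶠ δ : ℝ in 𝓝[>] 0, p + δ • (v + w) ∈ s := by
  have hlim : Tendsto (fun δ : ℝ => 2 * δ) (𝓝[>] 0) (𝓝[>] 0) := by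
    refine tendsto_nhdsWithin_iff.2 ⟨?_, ?_⟩
    · have : ContinuousAt (fun δ : ℝ => 2 * δ) 0 := by fun_prop
      simpa [ContinuousAt] using this.tendsto.mono_left (nhdsWithin_le_nhds (s := Ioi 0))
    · filter_upwards [self_mem_nhdsWithin] with δ hδ
      simpa using hδ
  filter_upwards [hlim.eventually hv, hlim.eventually hw] with δ h₁ h₂
  convert hs h₁ h₂ (a := 1 / 2) (b := 1 / 2) (by norm_num) (by norm_num) (by norm_num) using 1
  module

theorem Convex.eventually_add_smul_sum_mem {ι : Type*} {s : Set E} (hs : Convex ℝ s) {p : E}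
    (hp : p ∈ s) (J : Finset ι) (c : ι → ℝ) (q : ι → E) (hc : ∀ j ∈ J, 0 ≤ c j)
    (hq : ∀ j ∈ J, q j ∈ s) :
    ∀ᶠ δ : ℝ in 𝓝[>] 0, p + δ • ∑ j ∈ J, c j • (q j - p) ∈ s := by
  refine Finset.sum_induction (fun j => c j • (q j - p))
    (fun v => ∀ᶠ δ : ℝ in 𝓝[>] 0, p + δ • v ∈ s)
    (fun _ _ => hs.eventually_add_smul_add_mem) (by simp [hp])
    fun j hj => hs.eventually_add_smul_smul_sub_mem hp (hq j hj) (hc j hj)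

theorem HasDerivWithinAt.eventually_norm_sub_le {f : ℝ → E} {f' : E} {t c : ℝ}
    (hf : HasDerivWithinAt f f' (Ici t) t) (hc : ‖f'‖ < c) :
    ∀ᶠ s in 𝓝[>] t, ‖f s - f t‖ ≤ (s - t) * c := by
  filter_upwards [(hf.mono Ioi_subset_Ici_self).limsup_norm_slope_le hc, self_mem_nhdsWithin]
    with s hs hts
  have hpos : 0 < s - t := sub_pos.2 hts
  rw [Real.norm_of_nonneg hpos.le, inv_mul_lt_iff₀ hpos] at hs
  exact hs.le

/-- If a point moves with velocity `v + w`, where the direction `v` does not increase the distance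
to the convex hull of a family `y` above `M`, and `y` moves with velocity `u`, then the upper right
Dini derivative of the distance is controlled by `‖u‖ + ‖w‖`. -/
theorem eventually_infDist_convexHull_range_le {ι : Type*} [Fintype ι] [Nonempty ι]
    {x : ℝ → E} {y : ℝ → ι → E} {v w : E} {u : ι → E} {t M c : ℝ}
    (hx : HasDerivWithinAt x (v + w) (Ici t) t) (hy : HasDerivWithinAt y u (Ici t) t)
    (hv : ∀ᶠ δ : ℝ in 𝓝[>] 0, infDist (x t + δ • v) (convexHull ℝ (range (y t))) ≤ M)
    (hc : ‖u‖ + ‖w‖ < c) :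
    ∀ᶠ s in 𝓝[>] t, infDist (x s) (convexHull ℝ (range (y s))) ≤ M + (s - t) * c := by
  obtain ⟨c₁, hw, hc₁⟩ : ∃ c₁, ‖w‖ < c₁ ∧ c₁ < c - ‖u‖ := exists_between (by linarith)
  have hz : HasDerivWithinAt (fun s => x s - (s - t) • v) w (Ici t) t := by
    have h := hx.fun_sub (((hasDerivWithinAt_id t (Ici t)).sub_const t).smul_const v)
    simpa using h
  have hlim : Tendsto (fun s : ℝ => s - t) (𝓝[>] t) (𝓝[>] 0) := by
    refine tendsto_nhdsWithin_iff.2 ⟨?_, ?_⟩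
    · have : ContinuousAt (fun s : ℝ => s - t) t := by fun_prop
      simpa [ContinuousAt] using this.tendsto.mono_left (nhdsWithin_le_nhds (s := Ioi t))
    · filter_upwards [self_mem_nhdsWithin] with s hs
      simpa using hs
  filter_upwards [hz.eventually_norm_sub_le hw,
    hy.eventually_norm_sub_le (c := c - c₁) (by linarith), hlim.eventually hv] with s h₁ h₂ h₃
  have h₄ := infDist_convexHull_range_le_add_dist (y t) (y s) (x s)
  have h₅ := infDist_le_infDist_add_dist (s := convexHull ℝ (range (y t)))
    (x := x s) (y := x t + (s - t) • v)
  have h₆ : x s - (s - t) • v - (x t - (t - t) • v) = x s - (x t + (s - t) • v) := by module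
  rw [h₆, ← dist_eq_norm] at h₁
  rw [← dist_eq_norm, dist_comm] at h₂
  linarith

theorem continuous_infDist_convexHull_range_s19 {ι : Type*} [Fintype ι] [Nonempty ι]
    {x : ℝ → E} {y : ℝ → ι → E} (hx : Continuous x) (hy : Continuous y) :
    Continuous fun t => infDist (x t) (convexHull ℝ (range (y t))) := by
  have hL : LipschitzWith 2 fun q : E × (ι → E) => infDist q.1 (convexHull ℝ (range q.2)) := by
    refine LipschitzWith.of_le_add_mul 2 fun q q' => ?_
    have h₁ := infDist_convexHull_range_le_add_dist q'.2 q.2 q.1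
    have h₂ := infDist_le_infDist_add_dist (s := convexHull ℝ (range q'.2)) (x := q.1) (y := q'.1)
    have h₃ : dist q.1 q'.1 ≤ dist q q' := by
      rw [Prod.dist_eq]; exact le_max_left _ _
    have h₄ : dist q.2 q'.2 ≤ dist q q' := by
      rw [Prod.dist_eq]; exact le_max_right _ _
    rw [dist_comm] at h₁
    rw [NNReal.coe_ofNat]
    linarith
  have hcomp := hL.continuous.comp (hx.prodMk hy)
  exact hcomp

end Convexity

theorem MASSol.norm_add_norm_le_sqrt_two_mul_znorm {d n k : ℕ} {D : MASData d n k}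
    (sol : MASSol D) (t : ℝ) (i : Fin n) :
    ‖fun j => sol.u j (sol.y t) t‖ + ‖sol.w i t‖ ≤ Real.sqrt 2 * sol.znorm t := by
  set U := ∑ j : Fin k, ‖sol.u j (sol.y t) t‖ ^ 2
  set W := ∑ i : Fin n, ‖sol.w i t‖ ^ 2
  have hU : ‖fun j => sol.u j (sol.y t) t‖ ≤ Real.sqrt U := by
    refine (pi_norm_le_iff_of_nonneg (Real.sqrt_nonneg _)).2 fun j => Real.le_sqrt_of_sq_le ?_
    exact Finset.single_le_sum (f := fun j => ‖sol.u j (sol.y t) t‖ ^ 2)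
      (fun _ _ => sq_nonneg _) (Finset.mem_univ j)
  have hW : ‖sol.w i t‖ ≤ Real.sqrt W := by
    refine Real.le_sqrt_of_sq_le ?_
    exact Finset.single_le_sum (f := fun i => ‖sol.w i t‖ ^ 2)
      (fun _ _ => sq_nonneg _) (Finset.mem_univ i)
  have hU₀ : 0 ≤ U := Finset.sum_nonneg fun _ _ => sq_nonneg _
  have hW₀ : 0 ≤ W := Finset.sum_nonneg fun _ _ => sq_nonneg _
  refine (add_le_add hU hW).trans ?_
  rw [MASSol.znorm, ← Real.sqrt_mul zero_le_two]
  refine Real.le_sqrt_of_sq_le ?_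
  nlinarith [Real.sq_sqrt hU₀, Real.sq_sqrt hW₀, sq_nonneg (Real.sqrt U - Real.sqrt W)]

/-- A follower all of whose follower-neighbors are, like itself, within distance `M` of the leader
hull moves away from that hull beyond `M` at speed at most `√2 |z|`. -/
theorem MASSol.eventually_infDist_Lset_le_s19 {d n k : ℕ} {D : MASData d n k} (sol : MASSol D)
    {t M c : ℝ} (ht : 0 ≤ t) {i : Fin n} (hM : infDist (sol.x t i) (sol.Lset t) ≤ M)
    (hN : ∀ j ∈ D.Nb t i, infDist (sol.x t j) (sol.Lset t) ≤ M)
    (hc : Real.sqrt 2 * sol.znorm t < c) :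
    ∀ᶠ s in 𝓝[>] t, infDist (sol.x s i) (sol.Lset s) ≤ M + (s - t) * c := by
  have : Nonempty (Fin k) := ⟨⟨0, D.hk⟩⟩
  have hne : (sol.Lset t).Nonempty := (range_nonempty _).convexHull
  have hconv : Convex ℝ {p | infDist p (sol.Lset t) ≤ M} :=
    (convex_convexHull ℝ _).setOf_infDist_le hne M
  have hleader (j : Fin k) : infDist (sol.y t j) (sol.Lset t) ≤ M := by
    have hmem : sol.y t j ∈ sol.Lset t := subset_convexHull ℝ _ (mem_range_self j)
    rw [infDist_zero_of_mem hmem]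
    exact infDist_nonneg.trans hM
  exact eventually_infDist_convexHull_range_le (sol.dyn_x i t ht)
    (hasDerivWithinAt_pi.2 fun j => sol.dyn_y j t ht)
    (hconv.eventually_add_smul_add_mem
      (hconv.eventually_add_smul_sum_mem hM _ _ _
        (fun j _ => D.aLo_pos.le.trans (D.A_bdd i j _ _ t).1) hN)
      (hconv.eventually_add_smul_sum_mem hM _ _ _
        (fun j _ => D.bLo_pos.le.trans (D.B_bdd i j _ _ t)) fun j _ => hleader j))
    ((sol.norm_add_norm_le_sqrt_two_mul_znorm t i).trans_lt hc)

/-- **Lemma 14.**  Let `𝒱_F^1 ⊆ 𝒱_F` be nonempty and `T̂ > 0`.  If during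
`[t₁, t₁ + T̂)` no arcs of `G_{σ(t)}` leave `𝒱_F ∖ 𝒱_F^1` and enter `𝒱_F^1`,
and `dist(x_i(t₁), ℒ(y(t₁))) ≤ ε₀·|x(t₀)|_{ℒ(y(t₀))} + ĉ₀` for every
`i ∈ 𝒱_F^1`, then for every `i ∈ 𝒱_F^1` and `t ∈ [t₁, t₁ + T̂]`,
`dist(x_i(t), ℒ(y(t))) ≤ ε₀·|x(t₀)|_{ℒ(y(t₀))} + ĉ₀ + √2 ∫_{t₁}^{t} |z(s)| ds`. -/
theorem lemma14_isolated_subset {d n k : ℕ} (D : MASData d n k) (sol : MASSol D)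
    (VF1 : Finset (Fin n)) (hVF1 : VF1.Nonempty)
    (That t₀ t₁ : ℝ) (hThat : 0 < That) (ht₀ : 0 ≤ t₀) (ht₁ : t₀ ≤ t₁)
    (ε₀ c₀ : ℝ) (hε₀ : ε₀ ∈ Set.Ioo (0:ℝ) 1) (hc₀ : 0 < c₀)
    (hno : ∀ t ∈ Set.Ico t₁ (t₁ + That), ∀ m ∈ VF1, ∀ i : Fin n, i ∉ VF1 → i ∉ D.Nb t m)
    (hinit : ∀ i ∈ VF1,
      Metric.infDist (sol.x t₁ i) (sol.Lset t₁) ≤ ε₀ * sol.distL t₀ + c₀) :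
    ∀ i ∈ VF1, ∀ t ∈ Set.Icc t₁ (t₁ + That),
      Metric.infDist (sol.x t i) (sol.Lset t) ≤
        ε₀ * sol.distL t₀ + c₀ + Real.sqrt 2 * ∫ s in t₁..t, sol.znorm s := by
  intro i hi t ht
  have : Nonempty (Fin k) := ⟨⟨0, D.hk⟩⟩
  set g : ℝ → ℝ := fun s => VF1.sup' hVF1 fun i => infDist (sol.x s i) (sol.Lset s)
  have hle (s : ℝ) {j : Fin n} (hj : j ∈ VF1) : infDist (sol.x s j) (sol.Lset s) ≤ g s :=
    Finset.le_sup' (fun i => infDist (sol.x s i) (sol.Lset s)) hj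
  have hcont : Continuous g := Continuous.finset_sup'_apply hVF1 fun j _ =>
    continuous_infDist_convexHull_range_s19 (sol.x_cont j) (continuous_pi sol.y_cont)
  have hint : IntegrableOn (fun s => Real.sqrt 2 * sol.znorm s) (Icc t₁ t) :=
    (intervalIntegrable_iff_integrableOn_Icc_of_le ht.1).1 ((sol.z_int t₁ t).const_mul _)
  have hgrowth := sub_le_integral_of_eventually_sub_le ht.1 hcont.continuousOn hint
    fun s hs c hc => by
      have hev : ∀ j ∈ VF1, ∀ᶠ r in 𝓝[>] s,
          infDist (sol.x r j) (sol.Lset r) ≤ g s + (r - s) * c := fun j hj =>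
        sol.eventually_infDist_Lset_le_s19 (by linarith [hs.1]) (hle s hj)
          (fun m hm => hle s <| by
            by_contra hmem
            exact hno s ⟨hs.1, hs.2.trans_le ht.2⟩ j hj m hmem hm) hc
      filter_upwards [(Finset.eventually_all VF1).2 hev] with r hr
      rw [sub_le_iff_le_add']
      exact Finset.sup'_le hVF1 _ hr
  have hstart : g t₁ ≤ ε₀ * sol.distL t₀ + c₀ := Finset.sup'_le hVF1 _ hinit
  rw [intervalIntegral.integral_const_mul] at hgrowth
  linarith [hle t hi]
end
end
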